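/- For every n ≥ 1, let Σ_C = {A_{i1}, A_{i2}, A_{i3} | 1 ≤ i ≤ n} and Σ_R = {R}, and define the L(≥,⊓)-concepts C_i := ∃R.(A_{i1} ⊓ A_{i3}) ⊓ ∃R.(A_{i2} ⊓ A_{i3}), D_i := ∃R.(A_{i1} ⊓ A_{i2} ⊓ A_{i3}), D'_i := (≥ 2 R.A_{i3}) for 1 ≤ i ≤ n, and C := ⨅_{1≤i≤n} ∃R.( C_i ⊓ ⨅_{1≤j≤n, j≠i} (D_j ⊓ D'_j) ). Then every finite characterisation (E⁺,E⁻) of C w.r.t. L(≥,⊓)[Σ_C,Σ_R] satisfies |E⁺| ≥ 2^n. In particular, L(≥,⊓) does not admit polynomial-size finite characterisations, even for concepts of constant role depth and constant number restrictions. -/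

import Mathlib

namespace DL

/-! ### Syntax of ALCQI concepts -/

/-- Roles: role names (indexed by ℕ) and inverse roles. -/
inductive Role where
  | name : ℕ → Role
  | inv  : ℕ → Role
deriving DecidableEq

/-- ALCQI concept expressions. -/
inductive Concept where
  | atom : ℕ → Concept
  | top  : Concept
  | bot  : Concept
  | and  : Concept → Concept → Concept
  | or   : Concept → Concept → Concept
  | neg  : Concept → Concept
  | ex   : Role → Concept → Concept
  | all  : Role → Concept → Concept
  | atLeast : ℕ → Role → Concept → Concept
deriving DecidableEq

/-- The operators/constructors that a concept language may use. -/
inductive Op where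
  | all | ex | ge | inv | and | or | top | bot | neg
deriving DecidableEq

/-! ### Interpretations and semantics -/

/-- An interpretation: a nonempty domain, interpretations of concept names
and of role names. -/
structure Interp where
  Δ : Type
  dom_nonempty : Nonempty Δ
  atom : ℕ → Set Δ
  rel : ℕ → Δ → Δ → Prop

def Role.sem (I : Interp) : Role → (I.Δ → I.Δ → Prop)
  | .name R => I.rel R
  | .inv R  => fun d e => I.rel R e d

def Concept.sem (I : Interp) : Concept → Set I.Δ
  | .atom A => I.atom A
  | .top => Set.univ
  | .bot => ∅
  | .and C D => C.sem I ∩ D.sem I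
  | .or C D => C.sem I ∪ D.sem I
  | .neg C => (C.sem I)ᶜ
  | .ex S C => {d | ∃ e, S.sem I d e ∧ e ∈ C.sem I}
  | .all S C => {d | ∀ e, S.sem I d e → e ∈ C.sem I}
  | .atLeast k S C => {d | ∃ s : Finset I.Δ, s.card = k ∧ ∀ e ∈ s, S.sem I d e ∧ e ∈ C.sem I}

/-! ### Concept languages L(Os)[SC, SR] -/

def Role.inSig (Os : Finset Op) (SR : Finset ℕ) : Role → Prop
  | .name R => R ∈ SR
  | .inv R  => Op.inv ∈ Os ∧ R ∈ SR

/-- Membership of a concept in the language `L(Os)[SC, SR]`. -/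
def Concept.inLang (Os : Finset Op) (SC SR : Finset ℕ) : Concept → Prop
  | .atom A => A ∈ SC
  | .top => Op.top ∈ Os
  | .bot => Op.bot ∈ Os
  | .and C D => Op.and ∈ Os ∧ C.inLang Os SC SR ∧ D.inLang Os SC SR
  | .or C D => Op.or ∈ Os ∧ C.inLang Os SC SR ∧ D.inLang Os SC SR
  | .neg C => Op.neg ∈ Os ∧ C.inLang Os SC SR
  | .ex S C => Op.ex ∈ Os ∧ S.inSig Os SR ∧ C.inLang Os SC SR
  | .all S C => Op.all ∈ Os ∧ S.inSig Os SR ∧ C.inLang Os SC SR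
  | .atLeast k S C => Op.ge ∈ Os ∧ 1 ≤ k ∧ S.inSig Os SR ∧ C.inLang Os SC SR

/-! ### DL-Lite ontologies -/

/-- Basic concepts: concept names, ∃R and ∃R⁻. -/
inductive Basic where
  | atom : ℕ → Basic
  | ex : Role → Basic
deriving DecidableEq

def Basic.sem (I : Interp) : Basic → Set I.Δ
  | .atom A => I.atom A
  | .ex S => {d | ∃ e, S.sem I d e}

/-- A DL-Lite concept inclusion `B ⊑ C` where `C` is a basic concept
(`negated = false`) or a negated basic concept (`negated = true`). -/
structure CI where
  lhs : Basic
  rhs : Basic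
  negated : Bool
deriving DecidableEq

def CI.sat (I : Interp) (ci : CI) : Prop :=
  if ci.negated then ci.lhs.sem I ⊆ (ci.rhs.sem I)ᶜ else ci.lhs.sem I ⊆ ci.rhs.sem I

/-- A DL-Lite ontology: a finite set (list) of concept inclusions. -/
abbrev Ontology := List CI

def Interp.satO (I : Interp) (Ont : Ontology) : Prop := ∀ ci ∈ Ont, ci.sat I

/-! ### Pointed interpretations, examples, characterisations -/

structure PInterp where
  I : Interp
  pt : I.Δ

/-- A pointed interpretation is finite if its domain is finite. -/
def PInterp.finite (P : PInterp) : Prop := Finite P.I.Δ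

/-- `C` fits a collection `(Epos, Eneg)` of labelled examples. -/
def Fits (C : Concept) (Epos Eneg : List PInterp) : Prop :=
  (∀ e ∈ Epos, e.pt ∈ C.sem e.I) ∧ (∀ e ∈ Eneg, e.pt ∉ C.sem e.I)

/-- Equivalence of concepts. -/
def CEquiv (C D : Concept) : Prop := ∀ I : Interp, C.sem I = D.sem I

/-- Equivalence of concepts relative to an ontology. -/
def CEquivO (Ont : Ontology) (C D : Concept) : Prop :=
  ∀ I : Interp, I.satO Ont → C.sem I = D.sem I

/-- `⊨ C ⊑ D`. -/
def Subsumes (C D : Concept) : Prop := ∀ I : Interp, C.sem I ⊆ D.sem I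

/-- `Ont ⊨ C ⊑ D`. -/
def SubsumesO (Ont : Ontology) (C D : Concept) : Prop :=
  ∀ I : Interp, I.satO Ont → C.sem I ⊆ D.sem I

/-- `(Epos, Eneg)` is a finite characterisation of `C` w.r.t. the
concept language (predicate) `L`: all examples are finite, `C` fits,
and every fitting concept of `L` is equivalent to `C`. -/
def FinChar (L : Concept → Prop) (C : Concept) (Epos Eneg : List PInterp) : Prop :=
  (∀ e ∈ Epos ++ Eneg, e.finite) ∧
  Fits C Epos Eneg ∧
  ∀ D, L D → Fits D Epos Eneg → CEquiv C D

/-- Finite characterisation of `C` w.r.t. `L` under an ontology `Ont`: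
all examples are finite and satisfy `Ont`, `C` fits, and every fitting
concept of `L` is equivalent to `C` relative to `Ont`. -/
def FinCharO (Ont : Ontology) (L : Concept → Prop) (C : Concept)
    (Epos Eneg : List PInterp) : Prop :=
  (∀ e ∈ Epos ++ Eneg, e.finite ∧ e.I.satO Ont) ∧
  Fits C Epos Eneg ∧
  ∀ D, L D → Fits D Epos Eneg → CEquivO Ont C D

/-- `L(Os)` admits finite characterisations. -/
def AdmitsFinChar (Os : Finset Op) : Prop :=
  ∀ SC SR : Finset ℕ, ∀ C : Concept, C.inLang Os SC SR →
    ∃ Epos Eneg : List PInterp, FinChar (Concept.inLang Os SC SR) C Epos Eneg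

/-- `L(Os)` admits finite characterisations under the ontology `Ont`. -/
def AdmitsFinCharO (Os : Finset Op) (Ont : Ontology) : Prop :=
  ∀ SC SR : Finset ℕ, ∀ C : Concept, C.inLang Os SC SR →
    ∃ Epos Eneg : List PInterp, FinCharO Ont (Concept.inLang Os SC SR) C Epos Eneg

/-! ### Size, role depth, number restrictions -/

/-- Number of symbols of a concept expression (numbers in binary). -/
def Concept.size : Concept → ℕ
  | .atom _ => 1
  | .top => 1
  | .bot => 1
  | .and C D => C.size + D.size + 1
  | .or C D => C.size + D.size + 1
  | .neg C => C.size + 1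
  | .ex _ C => C.size + 2
  | .all _ C => C.size + 2
  | .atLeast k _ C => C.size + 2 + Nat.size k

/-- Role depth of a concept. -/
def Concept.dp : Concept → ℕ
  | .atom _ => 0
  | .top => 0
  | .bot => 0
  | .and C D => max C.dp D.dp
  | .or C D => max C.dp D.dp
  | .neg C => C.dp
  | .ex _ C => C.dp + 1
  | .all _ C => C.dp + 1
  | .atLeast _ _ C => C.dp + 1

/-- The largest number occurring in a number restriction of `C` (0 if none). -/
def Concept.nr : Concept → ℕ
  | .atom _ => 0
  | .top => 0
  | .bot => 0
  | .and C D => max C.nr D.nr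
  | .or C D => max C.nr D.nr
  | .neg C => C.nr
  | .ex _ C => C.nr
  | .all _ C => C.nr
  | .atLeast k _ C => max k C.nr

/-! Exponential lower bound on the size of finite characterisations for
`L(≥,⊓)`. The signature has concept names `A_{ij}` for `1 ≤ i ≤ n`,
`1 ≤ j ≤ 3` (encoded as the natural number `3*i + j`) and one role name `R`
(encoded as `0`). -/

/-- The single role name `R`. -/
def theRole : Role := Role.name 0

/-- The concept name `A_{ij}`, encoded as `3*i + j`. -/
def cn (i j : ℕ) : ℕ := 3 * i + j

/-- `Σ_C = {A_{i1}, A_{i2}, A_{i3} | 1 ≤ i ≤ n}`. -/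
def sigC (n : ℕ) : Finset ℕ :=
  ((Finset.Icc 1 n) ×ˢ (Finset.Icc 1 3)).image (fun p => 3 * p.1 + p.2)

/-- `Σ_R = {R}`. -/
def sigR : Finset ℕ := {0}

/-- `∃R.C`, an abbreviation for `≥ 1 R.C` in `L(≥,⊓)`. -/
def exR (C : Concept) : Concept := Concept.atLeast 1 theRole C

/-- `C_i := ∃R.(A_{i1} ⊓ A_{i3}) ⊓ ∃R.(A_{i2} ⊓ A_{i3})`. -/
def Ci (i : ℕ) : Concept :=
  Concept.and
    (exR (Concept.and (Concept.atom (cn i 1)) (Concept.atom (cn i 3))))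
    (exR (Concept.and (Concept.atom (cn i 2)) (Concept.atom (cn i 3))))

/-- `D_i := ∃R.(A_{i1} ⊓ A_{i2} ⊓ A_{i3})`. -/
def Di (i : ℕ) : Concept :=
  exR (Concept.and (Concept.atom (cn i 1))
    (Concept.and (Concept.atom (cn i 2)) (Concept.atom (cn i 3))))

/-- `D'_i := ≥ 2 R.A_{i3}`. -/
def Di' (i : ℕ) : Concept := Concept.atLeast 2 theRole (Concept.atom (cn i 3))

/-- Conjunction of the list `l` of concepts with a final conjunct `c`. -/
def conj1 : List Concept → Concept → Concept
  | [], c => c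
  | d :: l, c => Concept.and d (conj1 l c)

/-- `C_i ⊓ ⨅_{1≤j≤n, j≠i} (D_j ⊓ D'_j)` (with `C_i` as the last conjunct). -/
def inner (n i : ℕ) : Concept :=
  conj1 ((((List.range n).map (· + 1)).filter (· != i)).map
          (fun j => Concept.and (Di j) (Di' j)))
        (Ci i)

/-- `C := ⨅_{1≤i≤n} ∃R.( C_i ⊓ ⨅_{1≤j≤n, j≠i} (D_j ⊓ D'_j) )`. -/
def bigC (n : ℕ) : Concept :=
  conj1 (((List.range (n - 1)).map (· + 1)).map (fun i => exR (inner n i)))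
        (exR (inner n n))

lemma mem_sem_and {I : Interp} {d : I.Δ} {C D : Concept} :
    d ∈ (Concept.and C D).sem I ↔ d ∈ C.sem I ∧ d ∈ D.sem I := Iff.rfl

lemma mem_sem_exR {I : Interp} {d : I.Δ} {C : Concept} :
    d ∈ (exR C).sem I ↔ ∃ e, I.rel 0 d e ∧ e ∈ C.sem I := by
  constructor
  · rintro ⟨s, hs, h⟩
    obtain ⟨e, rfl⟩ := Finset.card_eq_one.1 hs
    exact ⟨e, h e (Finset.mem_singleton_self e)⟩
  · rintro ⟨e, he⟩
    refine ⟨{e}, Finset.card_singleton e, fun x hx => ?_⟩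
    rw [Finset.mem_singleton.1 hx]
    exact he

lemma mem_sem_atLeast_two {I : Interp} {d : I.Δ} {C : Concept} :
    d ∈ (Concept.atLeast 2 theRole C).sem I ↔
      ∃ e e', e ≠ e' ∧ (I.rel 0 d e ∧ e ∈ C.sem I) ∧ (I.rel 0 d e' ∧ e' ∈ C.sem I) := by
  classical
  constructor
  · rintro ⟨s, hs, h⟩
    obtain ⟨e, e', hne, rfl⟩ := Finset.card_eq_two.1 hs
    exact ⟨e, e', hne, h e (by simp), h e' (by simp)⟩
  · rintro ⟨e, e', hne, he, he'⟩
    refine ⟨{e, e'}, Finset.card_pair hne, fun x hx => ?_⟩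
    rcases Finset.mem_insert.1 hx with rfl | hx
    · exact he
    · rw [Finset.mem_singleton.1 hx]
      exact he'

lemma mem_sem_conj1 {I : Interp} {d : I.Δ} (l : List Concept) (c : Concept) :
    d ∈ (conj1 l c).sem I ↔ (∀ x ∈ l, d ∈ x.sem I) ∧ d ∈ c.sem I := by
  induction l with
  | nil => simp [conj1]
  | cons a l ih => simp [conj1, mem_sem_and, ih, and_assoc]

lemma inLang_conj1 {Os : Finset Op} {SC SR : Finset ℕ} (hand : Op.and ∈ Os)
    {l : List Concept} {c : Concept} (hl : ∀ x ∈ l, x.inLang Os SC SR)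
    (hc : c.inLang Os SC SR) : (conj1 l c).inLang Os SC SR := by
  induction l with
  | nil => exact hc
  | cons a l ih =>
    exact ⟨hand, hl a (by simp), ih fun x hx => hl x (by simp [hx])⟩

/-- The conjunction of `F 1, …, F n`, with `F n` as the last conjunct. -/
def conjUpTo (n : ℕ) (F : ℕ → Concept) : Concept :=
  conj1 (((List.range (n - 1)).map (· + 1)).map F) (F n)

lemma mem_sem_conjUpTo {I : Interp} {d : I.Δ} {n : ℕ} (hn : 1 ≤ n) (F : ℕ → Concept) :
    d ∈ (conjUpTo n F).sem I ↔ ∀ i ∈ Finset.Icc 1 n, d ∈ (F i).sem I := by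
  simp only [conjUpTo, mem_sem_conj1, List.mem_map, List.mem_range, Finset.mem_Icc]
  constructor
  · rintro ⟨h, h'⟩ i ⟨hi, hi'⟩
    rcases hi'.eq_or_lt with rfl | hlt
    · exact h'
    · exact h _ ⟨i, ⟨i - 1, by omega, by omega⟩, rfl⟩
  · refine fun h => ⟨?_, h n ⟨hn, le_rfl⟩⟩
    rintro _ ⟨_, ⟨i, hi, rfl⟩, rfl⟩
    exact h _ ⟨by omega, by omega⟩

lemma inLang_conjUpTo {Os : Finset Op} {SC SR : Finset ℕ} (hand : Op.and ∈ Os)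
    {n : ℕ} (hn : 1 ≤ n) {F : ℕ → Concept}
    (hF : ∀ i ∈ Finset.Icc 1 n, (F i).inLang Os SC SR) :
    (conjUpTo n F).inLang Os SC SR := by
  refine inLang_conj1 hand ?_ (hF n (Finset.mem_Icc.2 ⟨hn, le_rfl⟩))
  simp only [List.mem_map, List.mem_range]
  rintro _ ⟨_, ⟨i, hi, rfl⟩, rfl⟩
  exact hF _ (Finset.mem_Icc.2 ⟨by omega, by omega⟩)

lemma mem_sem_bigC {I : Interp} {d : I.Δ} {n : ℕ} (hn : 1 ≤ n) :
    d ∈ (bigC n).sem I ↔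
      ∀ i ∈ Finset.Icc 1 n, ∃ e, I.rel 0 d e ∧ e ∈ (inner n i).sem I := by
  simp_rw [← mem_sem_exR]
  exact mem_sem_conjUpTo hn fun i => exR (inner n i)

lemma mem_sem_inner {I : Interp} {d : I.Δ} {n i : ℕ} :
    d ∈ (inner n i).sem I ↔
      (∀ j ∈ Finset.Icc 1 n, j ≠ i → d ∈ (Di j).sem I ∧ d ∈ (Di' j).sem I) ∧
        d ∈ (Ci i).sem I := by
  simp only [inner, mem_sem_conj1, List.mem_map, List.mem_filter, List.mem_range, bne_iff_ne,
    Finset.mem_Icc]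
  refine and_congr_left fun _ => ⟨fun h j hj hji => ?_, ?_⟩
  · exact h _ ⟨j, ⟨⟨j - 1, by omega, by omega⟩, hji⟩, rfl⟩
  · rintro h _ ⟨_, ⟨⟨j, hj, rfl⟩, hji⟩, rfl⟩
    exact h _ ⟨by omega, by omega⟩ hji

/-- Two `A_{i3}`-successors witnessing `C_i` either coincide or are distinct. -/
lemma mem_sem_Di_or_Di' {I : Interp} {d : I.Δ} {i : ℕ} (h : d ∈ (Ci i).sem I) :
    d ∈ (Di i).sem I ∨ d ∈ (Di' i).sem I := by
  obtain ⟨e, he, h1, h3⟩ := mem_sem_exR.1 h.1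
  obtain ⟨e', he', h2, hthree⟩ := mem_sem_exR.1 h.2
  by_cases hee : e = e'
  · subst hee
    exact .inl (mem_sem_exR.2 ⟨e, he, h1, h2, h3⟩)
  · exact .inr (mem_sem_atLeast_two.2 ⟨e, e', hee, ⟨he, h3⟩, ⟨he', hthree⟩⟩)

/-- The concept `D_i` if `i ∈ S`, and `D'_i` otherwise. -/
def choice (S : Finset ℕ) (i : ℕ) : Concept := if i ∈ S then Di i else Di' i

/-- The concept `∃R.⨅_{1≤i≤n} choice S i`. -/
def exChoice (n : ℕ) (S : Finset ℕ) : Concept := exR (conjUpTo n (choice S))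

lemma mem_sem_exChoice_or {I : Interp} {d : I.Δ} {n : ℕ} (hn : 1 ≤ n)
    (hd : d ∈ (bigC n).sem I) {S T : Finset ℕ} {i : ℕ} (hi : i ∈ Finset.Icc 1 n)
    (hS : i ∈ S) (hT : i ∉ T) :
    d ∈ (exChoice n S).sem I ∨ d ∈ (exChoice n T).sem I := by
  obtain ⟨e, hde, he⟩ := (mem_sem_bigC hn).1 hd i hi
  obtain ⟨hj, hCi⟩ := mem_sem_inner.1 he
  have key : ∀ U : Finset ℕ, e ∈ (choice U i).sem I → d ∈ (exChoice n U).sem I := by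
    refine fun U hU => mem_sem_exR.2 ⟨e, hde, (mem_sem_conjUpTo hn _).2 fun j hjn => ?_⟩
    by_cases hji : j = i
    · exact hji ▸ hU
    · unfold choice
      split_ifs
      · exact (hj j hjn hji).1
      · exact (hj j hjn hji).2
  refine (mem_sem_Di_or_Di' hCi).imp (fun h => key S ?_) (fun h => key T ?_)
  · rwa [choice, if_pos hS]
  · rwa [choice, if_neg hT]

lemma cn_mem_sigC {n i k : ℕ} (hi : i ∈ Finset.Icc 1 n) (hk : k ∈ Finset.Icc 1 3) :
    cn i k ∈ sigC n :=
  Finset.mem_image.2 ⟨(i, k), Finset.mem_product.2 ⟨hi, hk⟩, rfl⟩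

section Language

variable {n i : ℕ}

lemma inLang_exR {SC : Finset ℕ} {C : Concept} (hC : C.inLang {Op.ge, Op.and} SC sigR) :
    (exR C).inLang {Op.ge, Op.and} SC sigR :=
  ⟨by decide, le_rfl, Finset.mem_singleton_self 0, hC⟩

lemma inLang_Ci (hi : i ∈ Finset.Icc 1 n) :
    (Ci i).inLang {Op.ge, Op.and} (sigC n) sigR :=
  ⟨by decide,
    inLang_exR ⟨by decide, cn_mem_sigC hi (by decide), cn_mem_sigC hi (by decide)⟩,
    inLang_exR ⟨by decide, cn_mem_sigC hi (by decide), cn_mem_sigC hi (by decide)⟩⟩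

lemma inLang_Di (hi : i ∈ Finset.Icc 1 n) :
    (Di i).inLang {Op.ge, Op.and} (sigC n) sigR :=
  inLang_exR ⟨by decide, cn_mem_sigC hi (by decide), by decide,
    cn_mem_sigC hi (by decide), cn_mem_sigC hi (by decide)⟩

lemma inLang_Di' (hi : i ∈ Finset.Icc 1 n) :
    (Di' i).inLang {Op.ge, Op.and} (sigC n) sigR :=
  ⟨by decide, by decide, Finset.mem_singleton_self 0, cn_mem_sigC hi (by decide)⟩

lemma inLang_inner (hi : i ∈ Finset.Icc 1 n) :
    (inner n i).inLang {Op.ge, Op.and} (sigC n) sigR := by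
  refine inLang_conj1 (by decide) ?_ (inLang_Ci hi)
  simp only [List.mem_map, List.mem_filter, List.mem_range]
  rintro _ ⟨_, ⟨⟨j, hj, rfl⟩, -⟩, rfl⟩
  have hj' : j + 1 ∈ Finset.Icc 1 n := Finset.mem_Icc.2 ⟨by omega, by omega⟩
  exact ⟨by decide, inLang_Di hj', inLang_Di' hj'⟩

lemma inLang_bigC (hn : 1 ≤ n) : (bigC n).inLang {Op.ge, Op.and} (sigC n) sigR :=
  inLang_conjUpTo (F := fun i => exR (inner n i)) (by decide) hn
    fun _ hi => inLang_exR (inLang_inner hi)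

lemma inLang_exChoice (hn : 1 ≤ n) (S : Finset ℕ) :
    (exChoice n S).inLang {Op.ge, Op.and} (sigC n) sigR := by
  refine inLang_exR (inLang_conjUpTo (by decide) hn fun i hi => ?_)
  unfold choice
  split_ifs
  · exact inLang_Di hi
  · exact inLang_Di' hi

end Language

/-- The domain of a tree whose inner nodes `mid i` each have two leaves as children. -/
inductive Node where
  | root : Node
  | mid : ℕ → Node
  | leaf : ℕ → Bool → Node

/-- A tree in which `mid i` satisfies `inner n i` but not `choice S i`. -/
def sepInterp (n : ℕ) (S : Finset ℕ) : Interp where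
  Δ := Node
  dom_nonempty := ⟨.root⟩
  atom A := {x | ∃ i b, x = .leaf i b ∧
    (i ∈ S → A ≠ cn i (if b then 1 else 2)) ∧ (i ∉ S → b = true → A ≠ cn i 3)}
  rel _ x y := (∃ i ∈ Finset.Icc 1 n, x = .root ∧ y = .mid i) ∨
    ∃ i b, x = .mid i ∧ y = .leaf i b

section Separation

variable {n : ℕ} {S : Finset ℕ} {i : ℕ} {b : Bool}

lemma sepInterp_rel_root {x : Node} :
    (sepInterp n S).rel 0 Node.root x ↔ ∃ i ∈ Finset.Icc 1 n, x = .mid i := by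
  simp [sepInterp]

lemma sepInterp_rel_mid {x : Node} :
    (sepInterp n S).rel 0 (Node.mid i) x ↔ ∃ b, x = .leaf i b := by
  simp [sepInterp]

lemma leaf_mem_atom {A : ℕ} :
    (Node.leaf i b ∈ (Concept.atom A).sem (sepInterp n S)) ↔
      (i ∈ S → A ≠ cn i (if b then 1 else 2)) ∧ (i ∉ S → b = true → A ≠ cn i 3) := by
  constructor
  · rintro ⟨_, _, h, hA⟩
    cases h
    exact hA
  · exact fun hA => ⟨i, b, rfl, hA⟩

lemma leaf_mem_atom_cn_of_ne {j k : ℕ} (hk : k ∈ Finset.Icc 1 3) (hji : j ≠ i) :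
    Node.leaf i b ∈ (Concept.atom (cn j k)).sem (sepInterp n S) := by
  rw [Finset.mem_Icc] at hk
  rw [leaf_mem_atom]
  refine ⟨fun _ => ?_, fun _ _ => ?_⟩
  · unfold cn
    split_ifs <;> omega
  · unfold cn
    omega

lemma mid_mem_Ci : Node.mid i ∈ (Ci i).sem (sepInterp n S) := by
  refine ⟨mem_sem_exR.2 ⟨.leaf i false, sepInterp_rel_mid.2 ⟨_, rfl⟩, ?_⟩,
    mem_sem_exR.2 ⟨.leaf i (decide (i ∈ S)), sepInterp_rel_mid.2 ⟨_, rfl⟩, ?_⟩⟩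
  · exact ⟨leaf_mem_atom.2 (by simp [cn]), leaf_mem_atom.2 (by simp [cn])⟩
  · constructor <;> refine leaf_mem_atom.2 ?_ <;> by_cases h : i ∈ S <;> simp [h, cn]

lemma root_mem_bigC (hn : 1 ≤ n) : Node.root ∈ (bigC n).sem (sepInterp n S) := by
  refine (mem_sem_bigC hn).2 fun i hi => ⟨.mid i, sepInterp_rel_root.2 ⟨i, hi, rfl⟩,
    mem_sem_inner.2 ⟨fun j _ hji => ⟨?_, ?_⟩, mid_mem_Ci⟩⟩
  · exact mem_sem_exR.2 ⟨.leaf i true, sepInterp_rel_mid.2 ⟨_, rfl⟩,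
      leaf_mem_atom_cn_of_ne (by decide) hji, leaf_mem_atom_cn_of_ne (by decide) hji,
      leaf_mem_atom_cn_of_ne (by decide) hji⟩
  · exact mem_sem_atLeast_two.2 ⟨.leaf i true, .leaf i false, nofun,
      ⟨sepInterp_rel_mid.2 ⟨_, rfl⟩, leaf_mem_atom_cn_of_ne (by decide) hji⟩,
      ⟨sepInterp_rel_mid.2 ⟨_, rfl⟩, leaf_mem_atom_cn_of_ne (by decide) hji⟩⟩

lemma mid_notMem_Di (hi : i ∈ S) : Node.mid i ∉ (Di i).sem (sepInterp n S) := by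
  intro h
  obtain ⟨_, he, h1, h2, -⟩ := mem_sem_exR.1 h
  obtain ⟨b, rfl⟩ := sepInterp_rel_mid.1 he
  cases b
  · exact (leaf_mem_atom.1 h2).1 hi rfl
  · exact (leaf_mem_atom.1 h1).1 hi rfl

lemma mid_notMem_Di' (hi : i ∉ S) : Node.mid i ∉ (Di' i).sem (sepInterp n S) := by
  intro h
  obtain ⟨_, _, hne, ⟨he, h3⟩, he', hthree⟩ := mem_sem_atLeast_two.1 h
  obtain ⟨b, rfl⟩ := sepInterp_rel_mid.1 he
  obtain ⟨b', rfl⟩ := sepInterp_rel_mid.1 he'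
  have hb : b = false := by
    by_contra hb
    exact (leaf_mem_atom.1 h3).2 hi (by simpa using hb) rfl
  have hb' : b' = false := by
    by_contra hb'
    exact (leaf_mem_atom.1 hthree).2 hi (by simpa using hb') rfl
  exact hne (by rw [hb, hb'])

lemma root_notMem_exChoice (hn : 1 ≤ n) :
    Node.root ∉ (exChoice n S).sem (sepInterp n S) := by
  intro h
  obtain ⟨_, he, h⟩ := mem_sem_exR.1 h
  obtain ⟨i, hi, rfl⟩ := sepInterp_rel_root.1 he
  have hmem := (mem_sem_conjUpTo hn _).1 h i hi
  unfold choice at hmem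
  split_ifs at hmem with hiS
  · exact mid_notMem_Di hiS hmem
  · exact mid_notMem_Di' hiS hmem

end Separation

/-- Since `C ⊓ exChoice n S` is strictly stronger than `C`, some positive example must refute
`exChoice n S`. -/
lemma exists_pos_notMem_exChoice {n : ℕ} (hn : 1 ≤ n) {Epos Eneg : List PInterp}
    (hchar : FinChar (Concept.inLang ({Op.ge, Op.and} : Finset Op) (sigC n) sigR)
      (bigC n) Epos Eneg) (S : Finset ℕ) :
    ∃ k : Fin Epos.length, Epos[k].pt ∉ (exChoice n S).sem Epos[k].I := by
  obtain ⟨-, ⟨hpos, hneg⟩, huniq⟩ := hchar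
  by_contra! hall
  have hfits : Fits (.and (bigC n) (exChoice n S)) Epos Eneg := by
    refine ⟨fun e he => ⟨hpos e he, ?_⟩, fun e he h => hneg e he h.1⟩
    obtain ⟨k, hk, rfl⟩ := List.getElem_of_mem he
    exact hall ⟨k, hk⟩
  have hequiv := huniq (.and (bigC n) (exChoice n S))
    ⟨by decide, inLang_bigC hn, inLang_exChoice hn S⟩ hfits
  have hroot := root_mem_bigC (S := S) hn
  rw [hequiv (sepInterp n S)] at hroot
  exact root_notMem_exChoice hn hroot.2

/-- **Theorem (exponential lower bound for `L(≥,⊓)`)**: for every `n ≥ 1`,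
every finite characterisation `(Epos, Eneg)` of `C` w.r.t.
`L(≥,⊓)[Σ_C, Σ_R]` has at least `2^n` positive examples. In particular,
`L(≥,⊓)` does not admit polynomial-size finite characterisations, even for
concepts of constant role depth and constant number restrictions. -/
theorem ELQ_exponential_lower_bound (n : ℕ) (hn : 1 ≤ n)
    (Epos Eneg : List PInterp)
    (hchar : FinChar (Concept.inLang ({Op.ge, Op.and} : Finset Op) (sigC n) sigR)
      (bigC n) Epos Eneg) :
    2 ^ n ≤ Epos.length := by
  choose k hk using exists_pos_notMem_exChoice hn hchar
  have key : ∀ S T : Finset ℕ, S ∈ (Finset.Icc 1 n).powerset → k S = k T → S ⊆ T := by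
    intro S T hS hST i hiS
    by_contra hiT
    have hC : Epos[k S].pt ∈ (bigC n).sem Epos[k S].I :=
      hchar.2.1.1 _ (List.getElem_mem _)
    rcases mem_sem_exChoice_or hn hC (Finset.mem_powerset.1 hS hiS) hiS hiT with h | h
    · exact hk S h
    · exact hk T (hST ▸ h)
  have hcard := Finset.card_le_card_of_injOn (s := (Finset.Icc 1 n).powerset)
    (t := Finset.univ) k (fun _ _ => Finset.mem_coe.2 (Finset.mem_univ _))
    fun S hS T hT h => (key S T hS h).antisymm (key T S hT h.symm)
  simpa using hcard

end DL
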